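/- arXiv:2308.00296 — 3 statements merged into one kernel-verified Lean document; each statement's English description precedes it below -/
import Mathlib

section
/- In the setting of the trajectory error recursion (same hypotheses: proportional model-error bound on X×U, f(·,u) Lipschitz with constant L_f on X, both trajectories from x̂ with controls u_0,…,u_{N−1} ∈ U remain in X), let additionally ℓ(x,u) := xᵀQx + uᵀRu with Q, R symmetric positive definite and let λ̲ > 0 be the smallest among the eigenvalues of Q and R. Then with e_n := ‖x̃(n) − x(n)‖, c̄ := max{L_Ψ, Δt·c̃} and d := L_f + ε·L_Ψ, for every n ∈ [1:N]: e_n² ≤ (4·ε²·c̄²/λ̲) · Σ_{i=0}^{n−1} (2d²)^{n−1−i} · ℓ(x(i),u_i). -/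
open scoped RealInnerProductSpace

/-- The trajectory of a discrete-time control system `x⁺ = g(x,u)` starting at `x0`
and driven by the control sequence `u`. -/
def traj {E F : Type*} (g : E → F → E) (x0 : E) (u : ℕ → F) : ℕ → E
  | 0 => x0
  | n + 1 => g (traj g x0 u n) (u n)

/-- The quadratic stage cost `ℓ(x,u) = xᵀQx + uᵀRu`. -/
noncomputable def quadCost {nx nc : ℕ}
    (Q : Matrix (Fin nx) (Fin nx) ℝ) (R : Matrix (Fin nc) (Fin nc) ℝ)
    (x : EuclideanSpace ℝ (Fin nx)) (u : EuclideanSpace ℝ (Fin nc)) : ℝ :=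
  ⟪x, (Matrix.toEuclideanCLM (𝕜 := ℝ) Q) x⟫ + ⟪u, (Matrix.toEuclideanCLM (𝕜 := ℝ) R) u⟫

theorem rayleigh_lower {m : ℕ} (Q : Matrix (Fin m) (Fin m) ℝ) (hQ : Q.IsHermitian) (lam : ℝ)
    (h : ∀ i, lam ≤ hQ.eigenvalues i) (x : EuclideanSpace ℝ (Fin m)) :
    lam * ‖x‖ ^ 2 ≤ ⟪x, (Matrix.toEuclideanCLM (𝕜 := ℝ) Q) x⟫ := by
  have hb : ∀ i, (Matrix.toEuclideanCLM (𝕜 := ℝ) Q) (hQ.eigenvectorBasis i)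
      = hQ.eigenvalues i • hQ.eigenvectorBasis i := by
    intro i
    have := hQ.mulVec_eigenvectorBasis i
    ext j
    have := congrFun this j
    simpa [Matrix.ofLp_toEuclideanCLM] using this
  have hsym : ∀ y z : EuclideanSpace ℝ (Fin m),
      ⟪y, (Matrix.toEuclideanCLM (𝕜 := ℝ) Q) z⟫ = ⟪(Matrix.toEuclideanCLM (𝕜 := ℝ) Q) y, z⟫ := by
    intro y z
    exact ((Matrix.isSymmetric_toEuclideanLin_iff.2 hQ) y z).symm
  rw [← hQ.eigenvectorBasis.sum_inner_mul_inner x, ← real_inner_self_eq_norm_sq,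
    ← hQ.eigenvectorBasis.sum_inner_mul_inner x x, Finset.mul_sum]
  refine Finset.sum_le_sum fun i _ => ?_
  rw [hsym, hb, inner_smul_left, real_inner_comm x]
  simp only [conj_trivial]
  nlinarith [mul_le_mul_of_nonneg_right (h i) (mul_self_nonneg ⟪x, hQ.eigenvectorBasis i⟫),
    real_inner_comm x (hQ.eigenvectorBasis i)]

/-- squared-error accumulation bound between the exact and the surrogate
trajectory, in terms of the accumulated stage cost along the exact trajectory. -/
theorem stmt_10 (nx nc : ℕ)
    (X : Set (EuclideanSpace ℝ (Fin nx))) (U : Set (EuclideanSpace ℝ (Fin nc)))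
    (f fε : EuclideanSpace ℝ (Fin nx) → EuclideanSpace ℝ (Fin nc) → EuclideanSpace ℝ (Fin nx))
    (ε LΨ Δt ctilde Lf : ℝ)
    (hε : 0 < ε) (hLΨ : 0 < LΨ) (hΔt : 0 < Δt) (hctilde : 0 < ctilde) (hLf : 0 < Lf)
    (herr : ∀ x ∈ X, ∀ u ∈ U, ‖f x u - fε x u‖ ≤ ε * (LΨ * ‖x‖ + Δt * ctilde * ‖u‖))
    (hLip : ∀ x ∈ X, ∀ y ∈ X, ∀ u ∈ U, ‖f x u - f y u‖ ≤ Lf * ‖x - y‖)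
    (Q : Matrix (Fin nx) (Fin nx) ℝ) (R : Matrix (Fin nc) (Fin nc) ℝ)
    (hQ : Q.PosDef) (hR : R.PosDef)
    -- `lamu` is the smallest among the eigenvalues of `Q` and `R`
    (lamu : ℝ) (hlamu : 0 < lamu)
    (hlamQ : ∀ i, lamu ≤ hQ.1.eigenvalues i) (hlamR : ∀ j, lamu ≤ hR.1.eigenvalues j)
    (hlam_min : (∃ i, lamu = hQ.1.eigenvalues i) ∨ (∃ j, lamu = hR.1.eigenvalues j))
    (xhat : EuclideanSpace ℝ (Fin nx)) (N : ℕ)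
    (u : ℕ → EuclideanSpace ℝ (Fin nc)) (hu : ∀ n < N, u n ∈ U)
    (hXex : ∀ n ≤ N, traj f xhat u n ∈ X) (hXsur : ∀ n ≤ N, traj fε xhat u n ∈ X) :
    ∀ n, 1 ≤ n → n ≤ N →
      ‖traj fε xhat u n - traj f xhat u n‖ ^ 2 ≤
        4 * ε ^ 2 * max LΨ (Δt * ctilde) ^ 2 / lamu *
          ∑ i ∈ Finset.range n,
            (2 * (Lf + ε * LΨ) ^ 2) ^ (n - 1 - i) * quadCost Q R (traj f xhat u i) (u i) := by
  have hcost : ∀ x v, lamu * (‖x‖ ^ 2 + ‖v‖ ^ 2) ≤ quadCost Q R x v := by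
    intro x v
    have h1 := rayleigh_lower Q hQ.1 lamu hlamQ x
    have h2 := rayleigh_lower R hR.1 lamu hlamR v
    unfold quadCost
    linarith
  set c := max LΨ (Δt * ctilde) with hc
  have hc1 : LΨ ≤ c := le_max_left _ _
  have hc2 : Δt * ctilde ≤ c := le_max_right _ _
  have hc0 : 0 < c := lt_of_lt_of_le hLΨ hc1
  have step : ∀ n < N, ‖traj fε xhat u (n + 1) - traj f xhat u (n + 1)‖ ^ 2 ≤
      2 * (Lf + ε * LΨ) ^ 2 * ‖traj fε xhat u n - traj f xhat u n‖ ^ 2 +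
        4 * ε ^ 2 * c ^ 2 / lamu * quadCost Q R (traj f xhat u n) (u n) := by
    intro n hn
    have hx := hXex n hn.le
    have hy := hXsur n hn.le
    have huu := hu n hn
    simp only [traj]
    generalize traj f xhat u n = x at *
    generalize traj fε xhat u n = y at *
    generalize u n = v at *
    have h1 := herr y hy v huu
    have h2 := hLip y hy x hx v huu
    have h3 : ‖fε y v - f x v‖ ≤ ‖f y v - fε y v‖ + ‖f y v - f x v‖ := by
      have : fε y v - f x v = (f y v - f x v) - (f y v - fε y v) := by abel
      rw [this]
      linarith [norm_sub_le (f y v - f x v) (f y v - fε y v)]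
    have h4 : ‖y‖ ≤ ‖y - x‖ + ‖x‖ := by
      simpa using norm_add_le (y - x) x
    have hr : LΨ * ‖y‖ + Δt * ctilde * ‖v‖ ≤ LΨ * ‖y - x‖ + c * (‖x‖ + ‖v‖) := by
      have a1 := mul_le_mul_of_nonneg_left h4 hLΨ.le
      have a2 := mul_le_mul_of_nonneg_right hc1 (norm_nonneg x)
      have a3 := mul_le_mul_of_nonneg_right hc2 (norm_nonneg v)
      linarith
    have hr' := mul_le_mul_of_nonneg_left hr hε.le
    have h5 : ‖fε y v - f x v‖ ≤ (Lf + ε * LΨ) * ‖y - x‖ + ε * c * (‖x‖ + ‖v‖) := by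
      linarith
    have h6 := pow_le_pow_left₀ (norm_nonneg _) h5 2
    have h7 : ‖x‖ ^ 2 + ‖v‖ ^ 2 ≤ quadCost Q R x v / lamu := by
      rw [le_div_iff₀ hlamu]
      linarith [hcost x v]
    have h8 := mul_le_mul_of_nonneg_left h7 (by positivity : 0 ≤ 4 * ε ^ 2 * c ^ 2)
    have h9 : (ε * c) ^ 2 * (‖x‖ + ‖v‖) ^ 2 ≤ (ε * c) ^ 2 * (2 * (‖x‖ ^ 2 + ‖v‖ ^ 2)) := by
      apply mul_le_mul_of_nonneg_left _ (by positivity)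
      nlinarith [sq_nonneg (‖x‖ - ‖v‖)]
    have h10 : 4 * ε ^ 2 * c ^ 2 / lamu * quadCost Q R x v
        = 4 * ε ^ 2 * c ^ 2 * (quadCost Q R x v / lamu) := by ring
    rw [h10]
    nlinarith [sq_nonneg ((Lf + ε * LΨ) * ‖y - x‖ - ε * c * (‖x‖ + ‖v‖))]
  have main : ∀ n, n + 1 ≤ N → ‖traj fε xhat u (n + 1) - traj f xhat u (n + 1)‖ ^ 2 ≤
        4 * ε ^ 2 * c ^ 2 / lamu *
          ∑ i ∈ Finset.range (n + 1),
            (2 * (Lf + ε * LΨ) ^ 2) ^ (n - i) * quadCost Q R (traj f xhat u i) (u i) := by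
    intro n
    induction n with
    | zero =>
      intro hn
      have := step 0 hn
      simpa [traj] using this
    | succ k ih =>
      intro hn
      have h1 := step (k + 1) hn
      have h2 := mul_le_mul_of_nonneg_left (ih (by omega))
        (by positivity : 0 ≤ 2 * (Lf + ε * LΨ) ^ 2)
      rw [Finset.sum_range_succ]
      have h3 : ∑ i ∈ Finset.range (k + 1),
            (2 * (Lf + ε * LΨ) ^ 2) ^ (k + 1 - i) * quadCost Q R (traj f xhat u i) (u i)
          = 2 * (Lf + ε * LΨ) ^ 2 * ∑ i ∈ Finset.range (k + 1),
            (2 * (Lf + ε * LΨ) ^ 2) ^ (k - i) * quadCost Q R (traj f xhat u i) (u i) := by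
        rw [Finset.mul_sum]
        refine Finset.sum_congr rfl fun i hi => ?_
        have : k + 1 - i = (k - i) + 1 := by
          have := Finset.mem_range.1 hi
          omega
        rw [this, pow_succ]
        ring
      rw [h3, Nat.sub_self, pow_zero, one_mul]
      linarith
  intro n hn hnN
  obtain ⟨k, rfl⟩ : ∃ k, n = k + 1 := ⟨n - 1, by omega⟩
  simpa using main k hnN
end

section
/- In the setting of the trajectory error recursion (same hypotheses: proportional model-error bound on X×U, f(·,u) Lipschitz with constant L_f on X, both trajectories from x̂ with controls u_0,…,u_{N−1} ∈ U remain in X), let ℓ(x,u) := xᵀQx + uᵀRu with Q, R symmetric positive definite, λ̲ > 0 the smallest among the eigenvalues of Q and R, and ℓ*(x) := inf_{u∈U} ℓ(x,u). Then with e_n := ‖x̃(n) − x(n)‖, c̄ := max{L_Ψ, Δt·c̃} and d := L_f + ε·L_Ψ, for every n ∈ [1:N]: e_n·‖x(n)‖ ≤ (ε·c̄/(2·λ̲)) · Σ_{i=0}^{n−1} d^{n−1−i} · ( ℓ(x(i),u_i) + 2·ℓ*(x(n)) ). -/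
open scoped RealInnerProductSpace

lemma quad_lower {m : ℕ} (Q : Matrix (Fin m) (Fin m) ℝ) (hQ : Q.IsHermitian) (l : ℝ)
    (hl : ∀ i, l ≤ hQ.eigenvalues i) (x : EuclideanSpace ℝ (Fin m)) :
    l * ‖x‖ ^ 2 ≤ ⟪x, (Matrix.toEuclideanCLM (𝕜 := ℝ) Q) x⟫ := by
  set T := Matrix.toEuclideanCLM (𝕜 := ℝ) Q with hT
  have hb : ∀ i, T (hQ.eigenvectorBasis i) = hQ.eigenvalues i • hQ.eigenvectorBasis i := by
    intro i
    apply (WithLp.equiv 2 _).injective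
    have := hQ.mulVec_eigenvectorBasis i
    simpa [hT] using this
  have hsa : ∀ y z, ⟪T y, z⟫ = ⟪y, T z⟫ := by
    have h1 : star T = T := by
      rw [hT, ← map_star, Matrix.star_eq_conjTranspose, hQ.eq]
    intro y z
    rw [← ContinuousLinearMap.adjoint_inner_right, ← ContinuousLinearMap.star_eq_adjoint, h1]
  rw [← hQ.eigenvectorBasis.sum_inner_mul_inner x (T x), ← real_inner_self_eq_norm_sq,
    ← hQ.eigenvectorBasis.sum_inner_mul_inner x x, Finset.mul_sum]
  refine Finset.sum_le_sum fun i _ => ?_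
  rw [← hsa, hb, real_inner_smul_left, real_inner_comm x]
  nlinarith [hl i, mul_self_nonneg ⟪x, hQ.eigenvectorBasis i⟫]

/-- cross-term bound between the trajectory error and the norm of the
exact trajectory, in terms of stage costs and the minimal stage cost `ℓ*`. -/
theorem stmt_11 (nx nc : ℕ)
    (X : Set (EuclideanSpace ℝ (Fin nx))) (U : Set (EuclideanSpace ℝ (Fin nc)))
    (f fε : EuclideanSpace ℝ (Fin nx) → EuclideanSpace ℝ (Fin nc) → EuclideanSpace ℝ (Fin nx))
    (ε LΨ Δt ctilde Lf : ℝ)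
    (hε : 0 < ε) (hLΨ : 0 < LΨ) (hΔt : 0 < Δt) (hctilde : 0 < ctilde) (hLf : 0 < Lf)
    (herr : ∀ x ∈ X, ∀ u ∈ U, ‖f x u - fε x u‖ ≤ ε * (LΨ * ‖x‖ + Δt * ctilde * ‖u‖))
    (hLip : ∀ x ∈ X, ∀ y ∈ X, ∀ u ∈ U, ‖f x u - f y u‖ ≤ Lf * ‖x - y‖)
    (Q : Matrix (Fin nx) (Fin nx) ℝ) (R : Matrix (Fin nc) (Fin nc) ℝ)
    (hQ : Q.PosDef) (hR : R.PosDef)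
    -- `lamu` is the smallest among the eigenvalues of `Q` and `R`
    (lamu : ℝ) (hlamu : 0 < lamu)
    (hlamQ : ∀ i, lamu ≤ hQ.1.eigenvalues i) (hlamR : ∀ j, lamu ≤ hR.1.eigenvalues j)
    (hlam_min : (∃ i, lamu = hQ.1.eigenvalues i) ∨ (∃ j, lamu = hR.1.eigenvalues j))
    (xhat : EuclideanSpace ℝ (Fin nx)) (N : ℕ)
    (u : ℕ → EuclideanSpace ℝ (Fin nc)) (hu : ∀ n < N, u n ∈ U)
    (hXex : ∀ n ≤ N, traj f xhat u n ∈ X) (hXsur : ∀ n ≤ N, traj fε xhat u n ∈ X) :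
    ∀ n, 1 ≤ n → n ≤ N →
      ‖traj fε xhat u n - traj f xhat u n‖ * ‖traj f xhat u n‖ ≤
        ε * max LΨ (Δt * ctilde) / (2 * lamu) *
          ∑ i ∈ Finset.range n,
            (Lf + ε * LΨ) ^ (n - 1 - i) *
              (quadCost Q R (traj f xhat u i) (u i) +
                2 * ⨅ w : U, quadCost Q R (traj f xhat u n) (w : EuclideanSpace ℝ (Fin nc))) := by
  intro n hn1 hnN
  have hd : 0 ≤ Lf + ε * LΨ := by positivity
  have hq : ∀ x w, lamu * (‖x‖ ^ 2 + ‖w‖ ^ 2) ≤ quadCost Q R x w := by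
    intro x w
    have h1 := quad_lower Q hQ.1 lamu hlamQ x
    have h2 := quad_lower R hR.1 lamu hlamR w
    unfold quadCost
    linarith
  have hrec : ∀ k, k ≤ N → ‖traj fε xhat u k - traj f xhat u k‖ ≤
      ε * max LΨ (Δt * ctilde) * ∑ i ∈ Finset.range k,
        (Lf + ε * LΨ) ^ (k - 1 - i) * (‖traj f xhat u i‖ + ‖u i‖) := by
    intro k
    induction k with
    | zero => intro _; simp [traj]
    | succ k ih =>
      intro hk
      have ih := ih (by omega)
      have hx := hXex k (by omega)
      have hy := hXsur k (by omega)
      have huk := hu k (by omega)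
      have hS : ∑ i ∈ Finset.range (k + 1),
          (Lf + ε * LΨ) ^ (k + 1 - 1 - i) * (‖traj f xhat u i‖ + ‖u i‖) =
          (Lf + ε * LΨ) * (∑ i ∈ Finset.range k,
            (Lf + ε * LΨ) ^ (k - 1 - i) * (‖traj f xhat u i‖ + ‖u i‖)) +
          (‖traj f xhat u k‖ + ‖u k‖) := by
        rw [Finset.sum_range_succ, Finset.mul_sum]
        congr 1
        · refine Finset.sum_congr rfl fun i hi => ?_
          have hi := Finset.mem_range.1 hi
          rw [show k + 1 - 1 - i = (k - 1 - i) + 1 by omega, pow_succ]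
          ring
        · simp
      rw [hS]
      simp only [traj]
      generalize traj f xhat u k = x at *
      generalize traj fε xhat u k = y at *
      have h1 := herr y hy _ huk
      have h2 := hLip y hy x hx _ huk
      have h3 : ‖fε y (u k) - f x (u k)‖ ≤ ‖f y (u k) - fε y (u k)‖ + ‖f y (u k) - f x (u k)‖ := by
        rw [norm_sub_rev (f y (u k)) (fε y (u k))]
        exact norm_sub_le_norm_sub_add_norm_sub _ _ _
      have h4 : ‖y‖ ≤ ‖y - x‖ + ‖x‖ := by
        simpa using norm_add_le (y - x) x
      have h5 : ε * (LΨ * ‖y‖) ≤ ε * (LΨ * (‖y - x‖ + ‖x‖)) := by gcongr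
      have h6 : ε * (LΨ * ‖x‖) ≤ ε * (max LΨ (Δt * ctilde) * ‖x‖) := by
        gcongr; exact le_max_left _ _
      have h7 : ε * (Δt * ctilde * ‖u k‖) ≤ ε * (max LΨ (Δt * ctilde) * ‖u k‖) := by
        gcongr; exact le_max_right _ _
      have h8 := mul_le_mul_of_nonneg_left ih hd
      nlinarith
  have hinf : lamu * ‖traj f xhat u n‖ ^ 2 ≤
      ⨅ w : U, quadCost Q R (traj f xhat u n) (w : EuclideanSpace ℝ (Fin nc)) := by
    have : Nonempty U := ⟨⟨u 0, hu 0 (by omega)⟩⟩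
    refine le_ciInf fun w => le_trans ?_ (hq _ _)
    gcongr
    nlinarith [sq_nonneg ‖(w : EuclideanSpace ℝ (Fin nc))‖]
  refine (mul_le_mul_of_nonneg_right (hrec n hnN) (norm_nonneg _)).trans ?_
  have hc : 0 ≤ ε * max LΨ (Δt * ctilde) := by positivity
  rw [div_eq_mul_inv, mul_assoc, mul_assoc (ε * max LΨ (Δt * ctilde))]
  refine mul_le_mul_of_nonneg_left ?_ hc
  rw [Finset.sum_mul, Finset.mul_sum]
  refine Finset.sum_le_sum fun i _ => ?_
  rw [mul_assoc, mul_left_comm (2 * lamu)⁻¹]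
  refine mul_le_mul_of_nonneg_left ?_ (pow_nonneg hd _)
  rw [inv_mul_eq_div, le_div_iff₀ (by positivity)]
  have h1 := hq (traj f xhat u i) (u i)
  have h2 : (‖traj f xhat u i‖ + ‖u i‖) * ‖traj f xhat u n‖ * 2 ≤
      ‖traj f xhat u i‖ ^ 2 + ‖u i‖ ^ 2 + 2 * ‖traj f xhat u n‖ ^ 2 := by
    nlinarith [sq_nonneg (‖traj f xhat u i‖ - ‖traj f xhat u n‖),
      sq_nonneg (‖u i‖ - ‖traj f xhat u n‖)]
  have h3 := mul_le_mul_of_nonneg_left h2 hlamu.le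
  linarith
end

section
/- Let X ⊂ ℝ^{n_x} be compact, U ⊂ ℝ^{n_c}, γ > 0, and let f^ε : ℝ^{n_x}×ℝ^{n_c} → ℝ^{n_x} satisfy ‖f^ε(x,u) − f^ε(y,u)‖ ≤ γ·‖x − y‖ for all x, y ∈ X and u ∈ U. Let ℓ(x,u) := xᵀQx + uᵀRu with Q, R symmetric positive definite and λ̄ ≥ ‖Q‖ (operator norm of Q). Let y₁, y₂ ∈ X and u ∈ U^N be such that both trajectories x_u^ε(k;y₁) and x_u^ε(k;y₂), k ∈ [0:N−1], remain in X. Then with Γ := Σ_{k=0}^{N−1} γ^k and R_X := sup_{x∈X} ‖x‖: |J_N^ε(y₁,u) − J_N^ε(y₂,u)| ≤ λ̄·Γ·( Γ·‖y₁ − y₂‖ + 2·N·R_X )·‖y₁ − y₂‖. -/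
open scoped RealInnerProductSpace

/-- The cost `J_N(x0,u) = ∑_{k=0}^{N-1} ℓ(x_u(k;x0), u(k))` along the dynamics `g`. -/
noncomputable def costJ {E F : Type*} (ℓ : E → F → ℝ) (g : E → F → E)
    (N : ℕ) (x0 : E) (u : ℕ → F) : ℝ :=
  ∑ k ∈ Finset.range N, ℓ (traj g x0 u k) (u k)

/-- sensitivity of the surrogate cost with respect to the initial state,
for a surrogate map which is uniformly Lipschitz in the state with constant `γ`. -/
theorem stmt_13 (nx nc : ℕ)
    (X : Set (EuclideanSpace ℝ (Fin nx))) (hXc : IsCompact X)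
    (U : Set (EuclideanSpace ℝ (Fin nc)))
    (γ : ℝ) (hγ : 0 < γ)
    (fε : EuclideanSpace ℝ (Fin nx) → EuclideanSpace ℝ (Fin nc) → EuclideanSpace ℝ (Fin nx))
    (hLip : ∀ x ∈ X, ∀ y ∈ X, ∀ u ∈ U, ‖fε x u - fε y u‖ ≤ γ * ‖x - y‖)
    (Q : Matrix (Fin nx) (Fin nx) ℝ) (R : Matrix (Fin nc) (Fin nc) ℝ)
    (hQ : Q.PosDef) (hR : R.PosDef)
    (lambar : ℝ)
    (hlam : ‖(Matrix.toEuclideanCLM (𝕜 := ℝ) Q :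
      EuclideanSpace ℝ (Fin nx) →L[ℝ] EuclideanSpace ℝ (Fin nx))‖ ≤ lambar)
    (N : ℕ) (y₁ y₂ : EuclideanSpace ℝ (Fin nx)) (hy₁ : y₁ ∈ X) (hy₂ : y₂ ∈ X)
    (u : ℕ → EuclideanSpace ℝ (Fin nc)) (hu : ∀ k < N, u k ∈ U)
    (htr₁ : ∀ k < N, traj fε y₁ u k ∈ X) (htr₂ : ∀ k < N, traj fε y₂ u k ∈ X) :
    |costJ (quadCost Q R) fε N y₁ u - costJ (quadCost Q R) fε N y₂ u| ≤
      lambar * (∑ k ∈ Finset.range N, γ ^ k) *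
        ((∑ k ∈ Finset.range N, γ ^ k) * ‖y₁ - y₂‖ + 2 * N * ⨆ x : X, ‖(x : EuclideanSpace ℝ (Fin nx))‖) *
          ‖y₁ - y₂‖ := by
  set S := ⨆ x : X, ‖(x : EuclideanSpace ℝ (Fin nx))‖ with hS
  set A : EuclideanSpace ℝ (Fin nx) →L[ℝ] EuclideanSpace ℝ (Fin nx) :=
    Matrix.toEuclideanCLM (𝕜 := ℝ) Q with hA
  have hbd : BddAbove (Set.range fun x : X => ‖(x : EuclideanSpace ℝ (Fin nx))‖) := by
    obtain ⟨C, hC⟩ := hXc.isBounded.exists_norm_le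
    exact ⟨C, by rintro _ ⟨x, rfl⟩; exact hC x x.2⟩
  have hle : ∀ x ∈ X, ‖x‖ ≤ S := fun x hx => le_ciSup hbd ⟨x, hx⟩
  have hS0 : 0 ≤ S := (norm_nonneg _).trans (hle y₁ hy₁)
  have hl0 : 0 ≤ lambar := (norm_nonneg _).trans hlam
  have hd : ∀ k, k < N → ‖traj fε y₁ u k - traj fε y₂ u k‖ ≤ γ ^ k * ‖y₁ - y₂‖ := by
    intro k
    induction k with
    | zero => intro _; simp [traj]
    | succ k ih =>
      intro hk
      have hk' : k < N := by omega
      calc _ ≤ γ * ‖traj fε y₁ u k - traj fε y₂ u k‖ :=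
            hLip _ (htr₁ k hk') _ (htr₂ k hk') _ (hu k hk')
        _ ≤ γ * (γ ^ k * ‖y₁ - y₂‖) := by gcongr; exact ih hk'
        _ = _ := by ring
  have hAn : ∀ x, ‖A x‖ ≤ lambar * ‖x‖ := fun x => A.le_of_opNorm_le hlam x
  have hstep : ∀ k ∈ Finset.range N,
      |quadCost Q R (traj fε y₁ u k) (u k) - quadCost Q R (traj fε y₂ u k) (u k)| ≤
        γ ^ k * (2 * lambar * S * ‖y₁ - y₂‖) := by
    intro k hk
    have hk := Finset.mem_range.1 hk
    have h1 := hle _ (htr₁ k hk)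
    have h2 := hle _ (htr₂ k hk)
    have h3 := hd k hk
    unfold quadCost
    rw [← hA]
    generalize traj fε y₁ u k = a at *
    generalize traj fε y₂ u k = b at *
    have e : ∀ r : ℝ, (⟪a, A a⟫ + r) - (⟪b, A b⟫ + r) = ⟪a - b, A a⟫ + ⟪b, A (a - b)⟫ := by
      intro r
      rw [map_sub, inner_sub_left, inner_sub_right]; ring
    rw [e]
    calc _ ≤ |⟪a - b, A a⟫| + |⟪b, A (a - b)⟫| := abs_add_le _ _
      _ ≤ ‖a - b‖ * ‖A a‖ + ‖b‖ * ‖A (a - b)‖ :=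
          add_le_add (abs_real_inner_le_norm _ _) (abs_real_inner_le_norm _ _)
      _ ≤ ‖a - b‖ * (lambar * ‖a‖) + ‖b‖ * (lambar * ‖a - b‖) := by
          gcongr
          · exact hAn a
          · exact hAn (a - b)
      _ ≤ (γ ^ k * ‖y₁ - y₂‖) * (lambar * S) + S * (lambar * (γ ^ k * ‖y₁ - y₂‖)) := by gcongr
      _ = _ := by ring
  unfold costJ
  rw [← Finset.sum_sub_distrib]
  rcases Nat.eq_zero_or_pos N with h0 | hN
  · subst h0; simp
  have hN1 : (1 : ℝ) ≤ N := by exact_mod_cast hN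
  have hG : 0 ≤ ∑ k ∈ Finset.range N, γ ^ k := Finset.sum_nonneg fun k _ => by positivity
  refine (Finset.abs_sum_le_sum_abs _ _).trans ((Finset.sum_le_sum hstep).trans ?_)
  rw [← Finset.sum_mul]
  generalize (∑ k ∈ Finset.range N, γ ^ k) = G at *
  calc _ = lambar * G * (0 + 2 * 1 * S) * ‖y₁ - y₂‖ := by ring
    _ ≤ _ := by
      gcongr
      positivity
end
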